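/- arXiv:2408.13165 — 2 statements merged into one kernel-verified Lean document; each statement's English description precedes it below -/
import Mathlib

section
/- Let K, t, γ_p be integers with t ≥ 2, 0 ≤ γ_p ≤ t−2, and t + γ_p + 1 ≤ K. Then the number of subsets I of ZMod K with |I| = 1 + t + γ_p that contain at least one cyclic interval of length t equals C(K−t, 1+γ_p) + (K−1)·C(K−t−1, 1+γ_p) − Σ_{i=1}^{t−1} C(K−t−1−(t−i), 1+γ_p−(t−i)), where C(n,k) denotes the binomial coefficient with the convention C(n,k) = 0 whenever n < 0, k < 0, or n < k. -/
/-- The cyclic interval `{i, i+1, ..., i+m−1}` (addition modulo `K`) in `ZMod K`. -/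
def cycInterval (K m : ℕ) (i : ZMod K) : Finset (ZMod K) :=
  (Finset.range m).image (fun j : ℕ => (i + (j : ZMod K)))

/-- `S` is a cyclic interval of length `m` in `ZMod K`. -/
def IsCycInterval (K m : ℕ) (S : Finset (ZMod K)) : Prop :=
  ∃ i : ZMod K, S = cycInterval K m i

/-- Binomial coefficient on integers with the convention `C(n,k) = 0` whenever
`n < 0`, `k < 0`, or `n < k`. -/
def binomZ (n k : ℤ) : ℤ :=
  if 0 ≤ n ∧ 0 ≤ k ∧ k ≤ n then n.toNat.choose k.toNat else 0

lemma binomZ_of_neg_right {n k : ℤ} (hk : k < 0) : binomZ n k = 0 :=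
  if_neg fun h => absurd h.2.1 (not_le.mpr hk)

lemma binomZ_of_lt {n k : ℤ} (hnk : n < k) : binomZ n k = 0 :=
  if_neg fun h => absurd h.2.2 (not_le.mpr hnk)

lemma binomZ_natCast (n k : ℕ) : binomZ n k = n.choose k := by
  unfold binomZ
  split_ifs with h
  · simp
  · rw [Nat.choose_eq_zero_of_lt (by omega), Nat.cast_zero]

/-- The hockey-stick identity along a diagonal of Pascal's triangle. -/
lemma sum_range_binomZ_diagonal (g : ℕ) : ∀ N s : ℕ, g ≤ N → g < s →
    ∑ j ∈ Finset.range s, binomZ ((N : ℤ) - j) ((g : ℤ) - j) = (N + 1).choose g := by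
  induction g with
  | zero =>
    intro N s _ hs
    obtain ⟨s, rfl⟩ : ∃ r, s = r + 1 := ⟨s - 1, by omega⟩
    rw [Finset.sum_range_succ', Finset.sum_eq_zero fun j _ =>
      binomZ_of_neg_right (by push_cast; omega)]
    simpa using binomZ_natCast N 0
  | succ g ih =>
    intro N s hN hs
    obtain ⟨s, rfl⟩ : ∃ r, s = r + 1 := ⟨s - 1, by omega⟩
    obtain ⟨N, rfl⟩ : ∃ M, N = M + 1 := ⟨N - 1, by omega⟩
    have h0 := binomZ_natCast (N + 1) (g + 1)
    have h1 := ih N s (by omega) (by omega)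
    rw [Finset.sum_range_succ', Nat.choose_succ_succ' (N + 1) g,
      Nat.cast_add ((N + 1).choose g), ← h0, ← h1]
    congr 1
    refine Finset.sum_congr rfl fun j _ => ?_
    congr 1 <;> push_cast <;> ring

lemma mem_cycInterval {K m : ℕ} {i x : ZMod K} :
    x ∈ cycInterval K m i ↔ ∃ j < m, i + (j : ZMod K) = x := by
  simp [cycInterval]

lemma card_cycInterval {K m : ℕ} (hm : m ≤ K) (i : ZMod K) : (cycInterval K m i).card = m := by
  rw [cycInterval, Finset.card_image_of_injOn, Finset.card_range]
  intro a ha b hb hab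
  simp only [Finset.coe_range, Set.mem_Iio] at ha hb
  have h := (ZMod.natCast_eq_natCast_iff' a b K).mp (add_left_cancel hab)
  rwa [Nat.mod_eq_of_lt (by omega), Nat.mod_eq_of_lt (by omega)] at h

lemma sub_one_notMem_cycInterval {K m : ℕ} (hm : m < K) (i : ZMod K) :
    i - 1 ∉ cycInterval K m i := by
  rw [mem_cycInterval]
  rintro ⟨j, hj, h⟩
  have h0 : ((j + 1 : ℕ) : ZMod K) = 0 := by
    push_cast
    linear_combination h
  have := Nat.le_of_dvd (by omega) ((ZMod.natCast_eq_zero_iff _ _).mp h0)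
  omega

lemma cycInterval_sub_one_subset {K m : ℕ} (i : ZMod K) :
    cycInterval K m (i - 1) ⊆ insert (i - 1) (cycInterval K m i) := by
  intro x hx
  obtain ⟨j, hj, rfl⟩ := mem_cycInterval.mp hx
  rw [Finset.mem_insert, mem_cycInterval]
  cases j with
  | zero => simp
  | succ j => exact Or.inr ⟨j, by omega, by push_cast; ring⟩

/-- A proper subset of `ZMod K` containing a cyclic interval of length `m` contains one that
cannot be extended to the left. -/
lemma exists_cycInterval_subset_sub_one_notMem {K m : ℕ} [NeZero K] (hm : 0 < m)
    {I : Finset (ZMod K)} (hI : I ≠ Finset.univ) {i : ZMod K} (hi : cycInterval K m i ⊆ I) :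
    ∃ k, k - 1 ∉ I ∧ cycInterval K m k ⊆ I := by
  by_contra! hcon
  refine hI (Finset.eq_univ_of_forall fun x => ?_)
  have hall : ∀ n : ℕ, cycInterval K m (i - n) ⊆ I := by
    intro n
    induction n with
    | zero => simpa using hi
    | succ n ih =>
      have hmem : i - n - 1 ∈ I := by
        by_contra h
        exact hcon _ h ih
      rw [Nat.cast_succ, ← sub_sub]
      exact (cycInterval_sub_one_subset _).trans (Finset.insert_subset hmem ih)
  exact hall (i - x).val (mem_cycInterval.mpr ⟨0, hm, by simp⟩)

lemma eq_or_sub_one_mem_of_not_disjoint {K m : ℕ} {i k : ZMod K}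
    (h : ¬Disjoint (cycInterval K m i) (cycInterval K m k)) :
    i = k ∨ i - 1 ∈ cycInterval K m k ∨ k - 1 ∈ cycInterval K m i := by
  obtain ⟨x, hxi, hxk⟩ := Finset.not_disjoint_iff.mp h
  obtain ⟨a, ha, rfl⟩ := mem_cycInterval.mp hxi
  obtain ⟨b, hb, hab⟩ := mem_cycInterval.mp hxk
  rcases lt_trichotomy a b with hlt | rfl | hlt
  · obtain ⟨c, rfl⟩ := Nat.exists_eq_add_of_lt hlt
    refine Or.inr (Or.inl (mem_cycInterval.mpr ⟨c, by omega, ?_⟩))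
    push_cast at hab
    linear_combination hab
  · exact Or.inl (add_right_cancel hab).symm
  · obtain ⟨c, rfl⟩ := Nat.exists_eq_add_of_lt hlt
    refine Or.inr (Or.inr (mem_cycInterval.mpr ⟨c, by omega, ?_⟩))
    push_cast at hab
    linear_combination -hab

/-- The number of sets of size `r + #A` that contain `A` and avoid `x`. -/
lemma card_filter_subset_notMem {α : Type*} [Fintype α] [DecidableEq α] (A : Finset α) {x : α}
    (hx : x ∉ A) (r : ℕ) :
    (Finset.univ.filter fun I : Finset α => I.card = r + A.card ∧ x ∉ I ∧ A ⊆ I).card =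
      (Fintype.card α - A.card - 1).choose r := by
  have hcard : (insert x A)ᶜ.card = Fintype.card α - A.card - 1 := by
    rw [Finset.card_compl, Finset.card_insert_of_notMem hx, Nat.sub_sub]
  rw [← hcard, ← Finset.card_powersetCard]
  refine Finset.card_nbij' (· \ A) (· ∪ A) ?_ ?_ ?_ ?_
  · intro I hI
    simp only [Finset.coe_filter, Finset.mem_univ, true_and, Set.mem_ofPred_eq] at hI
    simp only [Finset.mem_coe, Finset.mem_powersetCard]
    refine ⟨fun y hy => ?_, by rw [Finset.card_sdiff_of_subset hI.2.2]; omega⟩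
    simp only [Finset.mem_sdiff] at hy
    simp only [Finset.mem_compl, Finset.mem_insert, not_or]
    exact ⟨fun h => hI.2.1 (h ▸ hy.1), hy.2⟩
  · intro J hJ
    simp only [Finset.mem_coe, Finset.mem_powersetCard] at hJ
    have hdisj : Disjoint J A := Finset.disjoint_left.mpr fun y hy hyA =>
      Finset.mem_compl.mp (hJ.1 hy) (Finset.mem_insert_of_mem hyA)
    have hxJ : x ∉ J := fun h => Finset.mem_compl.mp (hJ.1 h) (Finset.mem_insert_self x A)
    simp only [Finset.coe_filter, Finset.mem_univ, true_and, Set.mem_ofPred_eq]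
    exact ⟨by rw [Finset.card_union_of_disjoint hdisj, hJ.2], by simp [hx, hxJ],
      Finset.subset_union_right⟩
  · intro I hI
    simp only [Finset.coe_filter, Finset.mem_univ, true_and, Set.mem_ofPred_eq] at hI
    exact Finset.sdiff_union_of_subset hI.2.2
  · intro J hJ
    simp only [Finset.mem_coe, Finset.mem_powersetCard] at hJ
    refine Finset.union_sdiff_cancel_right (Finset.disjoint_left.mpr fun y hy hyA => ?_)
    exact Finset.mem_compl.mp (hJ.1 hy) (Finset.mem_insert_of_mem hyA)

/-- The number of proper subsets of `ZMod K` of size `r + m < 2 * m` containing a cyclic interval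
of length `m`. -/
lemma ncard_cycInterval_subset {K m r : ℕ} (hr : r < m) (hK : r + m < K) :
    {I : Finset (ZMod K) | I.card = r + m ∧ ∃ S ⊆ I, IsCycInterval K m S}.ncard =
      K * (K - m - 1).choose r := by
  have : NeZero K := ⟨by omega⟩
  let F (i : ZMod K) : Finset (Finset (ZMod K)) := Finset.univ.filter fun I =>
    I.card = r + (cycInterval K m i).card ∧ i - 1 ∉ I ∧ cycInterval K m i ⊆ I
  have hF (i : ZMod K) (I : Finset (ZMod K)) :
      I ∈ F i ↔ I.card = r + m ∧ i - 1 ∉ I ∧ cycInterval K m i ⊆ I := by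
    simp [F, card_cycInterval (show m ≤ K by omega)]
  have hset : {I : Finset (ZMod K) | I.card = r + m ∧ ∃ S ⊆ I, IsCycInterval K m S} =
      (Finset.univ.biUnion F : Finset (Finset (ZMod K))) := by
    ext I
    simp only [Set.mem_ofPred_eq, Finset.coe_biUnion, Set.mem_iUnion, Finset.mem_coe, hF,
      Finset.mem_univ, exists_true_left]
    constructor
    · rintro ⟨hcard, _, hS, i, rfl⟩
      have hI : I ≠ Finset.univ := by
        rintro rfl
        rw [Finset.card_univ, ZMod.card] at hcard
        omega
      obtain ⟨k, hk⟩ := exists_cycInterval_subset_sub_one_notMem (by omega) hI hS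
      exact ⟨k, hcard, hk⟩
    · rintro ⟨i, hcard, -, hi⟩
      exact ⟨hcard, _, hi, i, rfl⟩
  have hdisj : ((Finset.univ : Finset (ZMod K)) : Set (ZMod K)).PairwiseDisjoint F := by
    intro i _ k _ hik
    refine Finset.disjoint_left.mpr fun I hIi hIk => ?_
    obtain ⟨hcard, hi, hiI⟩ := (hF i I).mp hIi
    obtain ⟨-, hk, hkI⟩ := (hF k I).mp hIk
    by_cases hd : Disjoint (cycInterval K m i) (cycInterval K m k)
    · have h := Finset.card_le_card (Finset.union_subset hiI hkI)
      rw [Finset.card_union_of_disjoint hd, card_cycInterval (by omega),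
        card_cycInterval (by omega)] at h
      omega
    · rcases eq_or_sub_one_mem_of_not_disjoint hd with h | h | h
      · exact hik h
      · exact hi (hkI h)
      · exact hk (hiI h)
  rw [hset, Set.ncard_coe_finset, Finset.card_biUnion hdisj,
    Finset.sum_congr rfl fun i _ =>
      card_filter_subset_notMem _ (sub_one_notMem_cycInterval (show m < K by omega) i) r]
  simp [card_cycInterval (show m ≤ K by omega), ZMod.card]

/-- **Total number of transmission-subsets, regime `γ_p ≤ t − 2`.**
For `t ≥ 2`, `0 ≤ γ_p ≤ t−2`, `t + γ_p + 1 ≤ K`, the number of subsets `I` of `ZMod K`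
with `|I| = 1 + t + γ_p` containing at least one cyclic interval of length `t` equals
`C(K−t, 1+γ_p) + (K−1)·C(K−t−1, 1+γ_p) − Σ_{i=1}^{t−1} C(K−t−1−(t−i), 1+γ_p−(t−i))`. -/
theorem count_transmission_subsets
    (K t γp : ℕ) (ht : 2 ≤ t) (hγp : γp ≤ t - 2) (hK : t + γp + 1 ≤ K) :
    ({I : Finset (ZMod K) | I.card = 1 + t + γp ∧
        ∃ S ⊆ I, IsCycInterval K t S}.ncard : ℤ) =
      binomZ ((K : ℤ) - t) (1 + γp) + ((K : ℤ) - 1) * binomZ ((K : ℤ) - t - 1) (1 + γp)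
        - ∑ i ∈ Finset.Icc 1 (t - 1),
            binomZ ((K : ℤ) - t - 1 - ((t : ℤ) - i)) (1 + (γp : ℤ) - ((t : ℤ) - i)) := by
  have hsum : ∑ i ∈ Finset.Icc 1 (t - 1),
      binomZ ((K : ℤ) - t - 1 - ((t : ℤ) - i)) (1 + (γp : ℤ) - ((t : ℤ) - i)) =
      ∑ j ∈ Finset.range (t - 1), binomZ ((K : ℤ) - t - 2 - j) ((γp : ℤ) - j) := by
    refine Finset.sum_nbij' (fun i => t - 1 - i) (fun j => t - 1 - j) ?_ ?_ ?_ ?_ ?_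
    · intro i hi
      rw [Finset.mem_Icc] at hi
      rw [Finset.mem_range]
      omega
    · intro j hj
      rw [Finset.mem_range] at hj
      rw [Finset.mem_Icc]
      omega
    · intro i hi
      rw [Finset.mem_Icc] at hi
      omega
    · intro j hj
      rw [Finset.mem_range] at hj
      omega
    · intro i hi
      rw [Finset.mem_Icc] at hi
      congr 1 <;> omega
  rw [hsum]
  rcases hK.eq_or_lt with rfl | hlt
  · have : NeZero (t + γp + 1) := ⟨by omega⟩
    have hset : {I : Finset (ZMod (t + γp + 1)) | I.card = 1 + t + γp ∧
        ∃ S ⊆ I, IsCycInterval (t + γp + 1) t S} = {Finset.univ} := by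
      ext I
      simp only [Set.mem_ofPred_eq, Set.mem_singleton_iff]
      constructor
      · rintro ⟨hcard, -⟩
        rw [← Finset.card_eq_iff_eq_univ, ZMod.card]
        omega
      · rintro rfl
        refine ⟨?_, _, Finset.subset_univ _, 0, rfl⟩
        rw [Finset.card_univ, ZMod.card]
        omega
    rw [hset, Set.ncard_singleton, binomZ_of_lt (n := _ - 1) (by push_cast; omega),
      Finset.sum_eq_zero fun j _ => binomZ_of_lt (by push_cast; omega)]
    have h := binomZ_natCast (1 + γp) (1 + γp)
    rw [Nat.choose_self] at h
    rw [mul_zero, add_zero, sub_zero, ← h]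
    congr 1
    push_cast
    ring
  · obtain ⟨N, rfl⟩ : ∃ N, K = N + t + 2 := ⟨K - t - 2, by omega⟩
    have hcount := ncard_cycInterval_subset (K := N + t + 2) (m := t) (r := γp + 1)
      (by omega) (by omega)
    rw [show 1 + t + γp = γp + 1 + t by omega, hcount,
      show N + t + 2 - t - 1 = N + 1 by omega]
    have hdiag := sum_range_binomZ_diagonal γp N (t - 1) (by omega) (by omega)
    have h1 := binomZ_natCast (N + 2) (γp + 1)
    have h2 := binomZ_natCast (N + 1) (γp + 1)
    rw [Nat.choose_succ_succ' (N + 1) γp] at h1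
    rw [show ((N + t + 2 : ℕ) : ℤ) - t - 2 = N by push_cast; ring,
      show ((N + t + 2 : ℕ) : ℤ) - t - 1 = (N + 1 : ℕ) by push_cast; ring,
      show ((N + t + 2 : ℕ) : ℤ) - t = (N + 2 : ℕ) by push_cast; ring,
      show 1 + (γp : ℤ) = (γp + 1 : ℕ) by push_cast; ring, hdiag, h1, h2]
    push_cast
    ring
end

section
/- Let K, t be integers with t ≥ 1 and 2t ≤ K, and set γ_p = t − 1. Then the number of subsets I of ZMod K with |I| = 2t that contain exactly one cyclic interval of length t equals K·( C(K−t−2, t) − (K−2t−1)⁺ ), where C(n,k) denotes the binomial coefficient with the convention C(n,k) = 0 whenever n < 0, k < 0, or n < k, and x⁺ = max(0,x). -/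
theorem cycInterval_subset_iff {K m : ℕ} {i : ZMod K} {I : Finset (ZMod K)} :
    cycInterval K m i ⊆ I ↔ ∀ w < m, i + (w : ZMod K) ∈ I := by
  simp [cycInterval, Finset.image_subset_iff]

theorem ZMod.natCast_inj_of_lt {K a b : ℕ} (ha : a < K) (hb : b < K)
    (h : (a : ZMod K) = b) : a = b := by
  rwa [ZMod.natCast_eq_natCast_iff', Nat.mod_eq_of_lt ha, Nat.mod_eq_of_lt hb] at h

theorem ZMod.exists_eq_add_natCast {K : ℕ} [NeZero K] (i x : ZMod K) :
    ∃ v < K, x = i + (v : ZMod K) :=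
  ⟨(x - i).val, ZMod.val_lt _, by simp⟩

theorem cycInterval_injective {K t : ℕ} (ht : 1 ≤ t) (hK : 2 * t ≤ K) :
    Function.Injective (cycInterval K t) := by
  intro i j h
  obtain ⟨u, hu, huj⟩ : ∃ u < t, i + (u : ZMod K) = j := by
    have hj : j ∈ cycInterval K t i := by
      rw [h]
      exact Finset.mem_image.2 ⟨0, by simp; omega, by simp⟩
    simpa [cycInterval] using hj
  obtain ⟨w, hw, hwi⟩ : ∃ w < t, j + (w : ZMod K) = i := by
    have hi : i ∈ cycInterval K t j := by
      rw [← h]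
      exact Finset.mem_image.2 ⟨0, by simp; omega, by simp⟩
    simpa [cycInterval] using hi
  have h0 : ((u + w : ℕ) : ZMod K) = (0 : ℕ) := by
    push_cast
    rw [← huj, add_assoc] at hwi
    simpa using hwi
  have := ZMod.natCast_inj_of_lt (by omega) (by omega) h0
  obtain rfl : u = 0 := by omega
  simpa using huj

theorem existsUnique_cycInterval_iff {K t : ℕ} (ht : 1 ≤ t) (hK : 2 * t ≤ K)
    {I : Finset (ZMod K)} :
    (∃! S : Finset (ZMod K), S ⊆ I ∧ IsCycInterval K t S) ↔
      ∃ i, ∀ j, cycInterval K t j ⊆ I ↔ j = i := by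
  constructor
  · rintro ⟨_, ⟨hI, i, rfl⟩, huniq⟩
    refine ⟨i, fun j => ⟨fun hj => ?_, fun hj => hj ▸ hI⟩⟩
    exact cycInterval_injective ht hK (huniq _ ⟨hj, j, rfl⟩)
  · rintro ⟨i, hi⟩
    refine ⟨cycInterval K t i, ⟨(hi i).2 rfl, i, rfl⟩, ?_⟩
    rintro _ ⟨hS, j, rfl⟩
    rw [(hi j).1 hS]

/-- If `i` is the only start of an interval of length `t` in `I`, the successor of that interval
is not in `I`. -/
theorem add_length_notMem {K t : ℕ} (hK : 2 ≤ K) {I : Finset (ZMod K)} {i : ZMod K}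
    (hi : ∀ j, cycInterval K t j ⊆ I ↔ j = i) : i + (t : ZMod K) ∉ I := by
  intro hmem
  have hI := cycInterval_subset_iff.1 ((hi i).2 rfl)
  have hsucc : i + ((1 : ℕ) : ZMod K) = i + ((0 : ℕ) : ZMod K) := by
    rw [Nat.cast_zero, add_zero, ← hi, cycInterval_subset_iff]
    intro w hw
    rw [add_assoc, ← Nat.cast_add]
    rcases Nat.lt_or_ge (1 + w) t with h | h
    · exact hI _ h
    · rwa [show 1 + w = t by omega]
  exact absurd (ZMod.natCast_inj_of_lt (by omega) (by omega) (add_left_cancel hsucc)) (by simp)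

/-- If `i` is the only start of an interval of length `t` in `I`, the predecessor of that interval
is not in `I`. -/
theorem add_pred_notMem {K t : ℕ} (hK : 2 ≤ K) {I : Finset (ZMod K)} {i : ZMod K}
    (hi : ∀ j, cycInterval K t j ⊆ I ↔ j = i) : i + ((K - 1 : ℕ) : ZMod K) ∉ I := by
  intro hmem
  have hI := cycInterval_subset_iff.1 ((hi i).2 rfl)
  have hpred : i + ((K - 1 : ℕ) : ZMod K) = i + ((0 : ℕ) : ZMod K) := by
    rw [Nat.cast_zero, add_zero, ← hi, cycInterval_subset_iff]
    rintro (_ | w) hw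
    · simpa using hmem
    · rw [add_assoc, ← Nat.cast_add, show K - 1 + (w + 1) = K + w by omega, Nat.cast_add,
        ZMod.natCast_self, zero_add]
      exact hI _ (by omega)
  have := ZMod.natCast_inj_of_lt (by omega) (by omega) (add_left_cancel hpred)
  omega

/-- The subset of `ZMod K` made of the interval of length `t` starting at `i` and of the elements
of `T`, placed after a gap following this interval. -/
def intervalWithGap (K t : ℕ) (i : ZMod K) (T : Finset ℕ) : Finset (ZMod K) :=
  (Finset.range t ∪ T.image (fun j => t + 1 + j)).image (fun v : ℕ => i + (v : ZMod K))

theorem injOn_add_natCast {K : ℕ} (i : ZMod K) :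
    Set.InjOn (fun v : ℕ => i + (v : ZMod K)) (Set.Iio K) :=
  fun _ ha _ hb h => ZMod.natCast_inj_of_lt ha hb (add_left_cancel h)

theorem offsets_subset {K t n : ℕ} (hn : n + t + 2 = K) {T : Finset ℕ}
    (hT : T ⊆ Finset.range n) :
    ∀ v ∈ Finset.range t ∪ T.image (fun j => t + 1 + j), v < K := by
  intro v hv
  simp only [Finset.mem_union, Finset.mem_range, Finset.mem_image] at hv
  rcases hv with hv | ⟨j, hj, rfl⟩
  · omega
  · have := Finset.mem_range.1 (hT hj)
    omega

theorem add_mem_intervalWithGap {K t n : ℕ} (hn : n + t + 2 = K) {i : ZMod K} {T : Finset ℕ}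
    (hT : T ⊆ Finset.range n) {v : ℕ} (hv : v < K) :
    i + (v : ZMod K) ∈ intervalWithGap K t i T ↔ v < t ∨ ∃ j ∈ T, t + 1 + j = v := by
  have hlt := offsets_subset hn hT
  rw [intervalWithGap, Finset.mem_image]
  constructor
  · rintro ⟨w, hw, hwv⟩
    obtain rfl := injOn_add_natCast i (hlt w hw) hv hwv
    simpa using hw
  · intro h
    exact ⟨v, by simpa using h, rfl⟩

theorem card_intervalWithGap {K t n : ℕ} (hn : n + t + 2 = K) {i : ZMod K} {T : Finset ℕ}
    (hT : T ⊆ Finset.range n) : (intervalWithGap K t i T).card = t + T.card := by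
  rw [intervalWithGap, Finset.card_image_of_injOn
    ((injOn_add_natCast i).mono fun v hv => offsets_subset hn hT v hv),
    Finset.card_union_of_disjoint, Finset.card_range,
    Finset.card_image_of_injective _ (add_right_injective _)]
  rw [Finset.disjoint_left]
  simp only [Finset.mem_range, Finset.mem_image, not_exists, not_and]
  intro a ha j _
  omega

theorem intervalWithGap_injective {K t n : ℕ} (hn : n + t + 2 = K) {i : ZMod K}
    {T T' : Finset ℕ} (hT : T ⊆ Finset.range n) (hT' : T' ⊆ Finset.range n)
    (h : intervalWithGap K t i T = intervalWithGap K t i T') : T = T' := by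
  ext j
  by_cases hj : j < n
  · have key : ∀ U ⊆ Finset.range n,
        (i + ((t + 1 + j : ℕ) : ZMod K) ∈ intervalWithGap K t i U ↔ j ∈ U) := by
      intro U hU
      rw [add_mem_intervalWithGap hn hU (by omega)]
      constructor
      · rintro (h | ⟨k, hk, hkj⟩)
        · omega
        · rwa [← add_left_cancel hkj]
      · exact fun h => Or.inr ⟨j, h, rfl⟩
    rw [← key T hT, h, key T' hT']
  · exact iff_of_false (fun h => hj (Finset.mem_range.1 (hT h)))
      (fun h => hj (Finset.mem_range.1 (hT' h)))

/-- The sets of `t` consecutive natural numbers below `n`. -/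
def natIntervals (n t : ℕ) : Finset (Finset ℕ) :=
  (Finset.range (n + 1 - t)).image (fun a => Finset.Ico a (a + t))

theorem natIntervals_subset (n t : ℕ) :
    natIntervals n t ⊆ Finset.powersetCard t (Finset.range n) := by
  intro T hT
  obtain ⟨a, ha, rfl⟩ := Finset.mem_image.1 hT
  rw [Finset.mem_range] at ha
  rw [Finset.mem_powersetCard]
  refine ⟨fun x hx => ?_, by simp⟩
  rw [Finset.mem_Ico] at hx
  rw [Finset.mem_range]
  omega

theorem card_natIntervals (n : ℕ) {t : ℕ} (ht : 1 ≤ t) : (natIntervals n t).card = n + 1 - t := by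
  rw [natIntervals, Finset.card_image_of_injective, Finset.card_range]
  intro a b h
  have ha : a ∈ Finset.Ico b (b + t) := by
    rw [← show Finset.Ico a (a + t) = Finset.Ico b (b + t) from h]
    simp; omega
  have hb : b ∈ Finset.Ico a (a + t) := by
    rw [show Finset.Ico a (a + t) = Finset.Ico b (b + t) from h]
    simp; omega
  rw [Finset.mem_Ico] at ha hb
  omega

theorem intervalWithGap_unique {K t n : ℕ} (ht : 1 ≤ t) (hn : n + t + 2 = K) {i : ZMod K}
    {T : Finset ℕ} (hT : T ⊆ Finset.range n) (hcard : T.card = t) (hTn : T ∉ natIntervals n t)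
    (j : ZMod K) : cycInterval K t j ⊆ intervalWithGap K t i T ↔ j = i := by
  have : NeZero K := ⟨by omega⟩
  rw [cycInterval_subset_iff]
  constructor
  · intro h
    obtain ⟨u, hu, rfl⟩ := ZMod.exists_eq_add_natCast i j
    have h' : ∀ v, u ≤ v → v < u + t → v < K → v < t ∨ ∃ j ∈ T, t + 1 + j = v := by
      intro v huv hvt hv
      rw [← add_mem_intervalWithGap (i := i) hn hT hv]
      have := h (v - u) (by omega)
      rwa [add_assoc, ← Nat.cast_add, Nat.add_sub_cancel' huv] at this
    rcases Nat.eq_zero_or_pos u with rfl | hu0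
    · simp
    exfalso
    rcases Nat.lt_or_ge t u with htu | htu
    · rcases Nat.lt_or_ge (u + t) K with hK | hK
      · apply hTn
        refine Finset.mem_image.2 ⟨u - (t + 1), by rw [Finset.mem_range]; omega, ?_⟩
        refine Finset.eq_of_subset_of_card_le (fun x hx => ?_) (by simp [hcard])
        rw [Finset.mem_Ico] at hx
        rcases h' (t + 1 + x) (by omega) (by omega) (by omega) with h | ⟨k, hk, hkx⟩
        · omega
        · rwa [← add_left_cancel hkx]
      · rcases h' (K - 1) (by omega) (by omega) (by omega) with h | ⟨k, hk, hkx⟩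
        · omega
        · have := Finset.mem_range.1 (hT hk)
          omega
    · rcases h' t htu (by omega) (by omega) with h | ⟨k, hk, hkx⟩ <;> omega
  · rintro rfl w hw
    exact (add_mem_intervalWithGap hn hT (by omega)).2 (Or.inl hw)

theorem exists_eq_intervalWithGap {K t n : ℕ} (ht : 1 ≤ t) (hn : n + t + 2 = K) {i : ZMod K}
    {I : Finset (ZMod K)} (hcard : I.card = 2 * t) (hi : ∀ j, cycInterval K t j ⊆ I ↔ j = i) :
    ∃ T ∈ Finset.powersetCard t (Finset.range n) \ natIntervals n t,
      intervalWithGap K t i T = I := by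
  have : NeZero K := ⟨by omega⟩
  set T := (Finset.range n).filter (fun j => i + ((t + 1 + j : ℕ) : ZMod K) ∈ I)
  have hT : T ⊆ Finset.range n := Finset.filter_subset _ _
  have hTI : intervalWithGap K t i T = I := by
    ext x
    obtain ⟨v, hv, rfl⟩ := ZMod.exists_eq_add_natCast i x
    rw [add_mem_intervalWithGap hn hT hv]
    constructor
    · rintro (h | ⟨j, hj, rfl⟩)
      · exact cycInterval_subset_iff.1 ((hi i).2 rfl) v h
      · exact (Finset.mem_filter.1 hj).2
    · intro h
      by_contra! hcon
      obtain ⟨hvt, hvT⟩ := hcon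
      rcases hvt.eq_or_lt with rfl | hvt
      · exact add_length_notMem (by omega) hi h
      · rcases Nat.lt_or_ge v (K - 1) with hvK | hvK
        · have hv' : t + 1 + (v - (t + 1)) = v := by omega
          refine hvT (v - (t + 1)) (Finset.mem_filter.2 ⟨?_, ?_⟩) hv'
          · rw [Finset.mem_range]; omega
          · rwa [hv']
        · obtain rfl : v = K - 1 := by omega
          exact add_pred_notMem (by omega) hi h
  have hTcard : T.card = t := by
    have := card_intervalWithGap hn (i := i) hT
    rw [hTI] at this
    omega
  refine ⟨T, Finset.mem_sdiff.2 ⟨Finset.mem_powersetCard.2 ⟨hT, hTcard⟩, fun hmem => ?_⟩, hTI⟩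
  obtain ⟨a, ha, haT⟩ := Finset.mem_image.1 hmem
  rw [Finset.mem_range] at ha
  have hlt : a + t ≤ n := by omega
  have hstart : i + ((t + 1 + a : ℕ) : ZMod K) = i + ((0 : ℕ) : ZMod K) := by
    rw [Nat.cast_zero, add_zero, ← hi, cycInterval_subset_iff]
    intro w hw
    have hmem : a + w ∈ T := by
      rw [← haT, Finset.mem_Ico]; omega
    rw [add_assoc, ← Nat.cast_add, add_assoc (t + 1)]
    exact (Finset.mem_filter.1 hmem).2
  have := ZMod.natCast_inj_of_lt (by omega) (by omega) (add_left_cancel hstart)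
  omega

theorem ncard_unique_cycInterval {K t n : ℕ} (ht : 1 ≤ t) (hn : n + t + 2 = K) (htn : t ≤ n) :
    {I : Finset (ZMod K) | I.card = 2 * t ∧
        ∃! S : Finset (ZMod K), S ⊆ I ∧ IsCycInterval K t S}.ncard =
      K * (n.choose t - (n + 1 - t)) := by
  have : NeZero K := ⟨by omega⟩
  set P := Finset.powersetCard t (Finset.range n) \ natIntervals n t with hP
  have hPmem : ∀ T ∈ P, T ⊆ Finset.range n ∧ T.card = t ∧ T ∉ natIntervals n t := by
    intro T hT
    rw [hP, Finset.mem_sdiff, Finset.mem_powersetCard] at hT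
    exact ⟨hT.1.1, hT.1.2, hT.2⟩
  have hset : {I : Finset (ZMod K) | I.card = 2 * t ∧
      ∃! S : Finset (ZMod K), S ⊆ I ∧ IsCycInterval K t S} =
      ((Finset.univ ×ˢ P).image (fun p => intervalWithGap K t p.1 p.2) :
        Finset (Finset (ZMod K))) := by
    ext I
    rw [Set.mem_ofPred_eq, existsUnique_cycInterval_iff ht (by omega), Finset.mem_coe,
      Finset.mem_image]
    constructor
    · rintro ⟨hcard, i, hi⟩
      obtain ⟨T, hT, hTI⟩ := exists_eq_intervalWithGap ht hn hcard hi
      exact ⟨(i, T), Finset.mem_product.2 ⟨Finset.mem_univ i, hT⟩, hTI⟩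
    · rintro ⟨⟨i, T⟩, hmem, rfl⟩
      obtain ⟨hT, hcard, hTn⟩ := hPmem T (Finset.mem_product.1 hmem).2
      refine ⟨?_, i, intervalWithGap_unique ht hn hT hcard hTn⟩
      rw [card_intervalWithGap hn hT, hcard, two_mul]
  rw [hset, Set.ncard_coe_finset, Finset.card_image_of_injOn, Finset.card_product,
    Finset.card_univ, ZMod.card, hP, Finset.card_sdiff_of_subset (natIntervals_subset n t),
    card_natIntervals n ht, Finset.card_powersetCard, Finset.card_range]
  rintro ⟨i, T⟩ hiT ⟨j, U⟩ hjU h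
  obtain ⟨hT, hTcard, hTn⟩ := hPmem T (Finset.mem_product.1 hiT).2
  obtain ⟨hU, hUcard, hUn⟩ := hPmem U (Finset.mem_product.1 hjU).2
  have h : intervalWithGap K t i T = intervalWithGap K t j U := h
  obtain rfl : i = j := by
    rw [← intervalWithGap_unique ht hn hU hUcard hUn, ← h,
      intervalWithGap_unique ht hn hT hTcard hTn]
  rw [intervalWithGap_injective hn hT hU h]

theorem not_existsUnique_cycInterval {K t : ℕ} (ht : 1 ≤ t) (hK : 2 * t ≤ K)
    (hK' : K ≤ 2 * t + 1) {I : Finset (ZMod K)} (hcard : I.card = 2 * t) :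
    ¬ ∃! S : Finset (ZMod K), S ⊆ I ∧ IsCycInterval K t S := by
  have : NeZero K := ⟨by omega⟩
  rw [existsUnique_cycInterval_iff ht hK]
  rintro ⟨i, hi⟩
  have h1 := add_length_notMem (by omega) hi
  have h2 := add_pred_notMem (by omega) hi
  have hcompl : Iᶜ.card ≤ 1 := by
    rw [Finset.card_compl, ZMod.card, hcard]
    omega
  have heq := Finset.card_le_one.1 hcompl _ (Finset.mem_compl.2 h1) _ (Finset.mem_compl.2 h2)
  have := ZMod.natCast_inj_of_lt (by omega) (by omega) (add_left_cancel heq)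
  have hpos := Finset.card_pos.2 ⟨_, Finset.mem_compl.2 h1⟩
  rw [Finset.card_compl, ZMod.card, hcard] at hpos
  omega

/-- **Number of Special Case 1 transmission-subsets, regime `γ_p = t − 1`.**
For `t ≥ 1` and `2t ≤ K`, the number of subsets `I` of `ZMod K` with `|I| = 2t`
containing exactly one cyclic interval of length `t` equals
`K·(C(K−t−2, t) − (K−2t−1)⁺)`. -/
theorem count_special_case_one_subsets_boundary
    (K t : ℕ) (ht : 1 ≤ t) (hK : 2 * t ≤ K) :
    ({I : Finset (ZMod K) | I.card = 2 * t ∧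
        ∃! S : Finset (ZMod K), S ⊆ I ∧ IsCycInterval K t S}.ncard : ℤ) =
      (K : ℤ) * (binomZ ((K : ℤ) - t - 2) t - max 0 ((K : ℤ) - 2 * t - 1)) := by
  rcases Nat.lt_or_ge K (2 * t + 2) with h | h
  · have hempty : {I : Finset (ZMod K) | I.card = 2 * t ∧
        ∃! S : Finset (ZMod K), S ⊆ I ∧ IsCycInterval K t S} = ∅ :=
      Set.eq_empty_of_forall_notMem fun I hI =>
        not_existsUnique_cycInterval ht hK (by omega) hI.1 hI.2
    rw [hempty, Set.ncard_empty, binomZ, if_neg (by omega), max_eq_left (by omega)]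
    simp
  · obtain ⟨n, rfl⟩ : ∃ n, K = n + t + 2 := ⟨K - t - 2, by omega⟩
    have htn : t ≤ n := by omega
    have hle : n + 1 - t ≤ n.choose t := by
      have := Finset.card_le_card (natIntervals_subset n t)
      rwa [card_natIntervals n ht, Finset.card_powersetCard, Finset.card_range] at this
    rw [ncard_unique_cycInterval ht rfl htn, binomZ, if_pos (by omega),
      max_eq_right (by omega), show ((n + t + 2 : ℕ) : ℤ) - t - 2 = n by push_cast; ring,
      Int.toNat_natCast, Int.toNat_natCast, Nat.cast_mul, Nat.cast_sub hle,
      Nat.cast_sub (by omega : t ≤ n + 1)]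
    push_cast
    ring
end
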